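/- Let S ∈ ℂ^{n×n}, γ > 0, let i, j be positive integers, and suppose the Q-iteration is breakdown-free up to step i + j. Then Q_i + Q_j is invertible and Q_{i+j} = (S + Q_i Q_j)(Q_i + Q_j)^{-1}. In particular (i = j = k), Q_{2k} = (S + Q_k^2)(2Q_k)^{-1}, the Newton iteration step for the matrix square root. -/

import Mathlib

open Matrix BigOperators

/-- A matrix commuting with `A` commutes with the nonsingular inverse of `A`. -/
theorem commute_nonsing_inv_right {n R : Type*} [Fintype n] [DecidableEq n] [CommRing R]
    {X A : Matrix n n R} (h : Commute X A) : Commute X A⁻¹ := by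
  by_cases hA : IsUnit A
  · have hdet := (Matrix.isUnit_iff_isUnit_det A).1 hA
    calc X * A⁻¹ = A⁻¹ * (A * X) * A⁻¹ := by
          rw [← mul_assoc, Matrix.nonsing_inv_mul A hdet, one_mul]
      _ = A⁻¹ * X := by
          rw [← h.eq, mul_assoc, mul_assoc, Matrix.mul_nonsing_inv A hdet, mul_one]
  · rw [Matrix.nonsing_inv_apply_not_isUnit A fun h' => hA ((Matrix.isUnit_iff_isUnit_det A).2 h')]
    exact Commute.zero_right X

section QIteration

variable {n R : Type*} [Fintype n] [DecidableEq n] [CommRing R]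
  {S : Matrix n n R} {c : R} {Q : ℕ → Matrix n n R}

/-- Every matrix commuting with `S` commutes with all iterates. -/
theorem qIteration_commute_of_commute (hQ1 : Q 1 = c • (1 : Matrix n n R))
    (hQrec : ∀ j, 1 ≤ j → Q (j + 1) = (c • Q j + S) * (c • (1 : Matrix n n R) + Q j)⁻¹)
    {X : Matrix n n R} (hX : Commute X S) {l : ℕ} (hl : 1 ≤ l) : Commute X (Q l) := by
  induction l, hl using Nat.le_induction with
  | base => rw [hQ1]; exact (Commute.one_right X).smul_right c
  | succ l hl ih =>
    rw [hQrec l hl]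
    exact ((ih.smul_right c).add_right hX).mul_right
      (commute_nonsing_inv_right (((Commute.one_right X).smul_right c).add_right ih))

/-- The addition formula for the iterates, in division-free form. -/
theorem qIteration_add (hQ1 : Q 1 = c • (1 : Matrix n n R))
    (hQrec : ∀ j, 1 ≤ j → Q (j + 1) = (c • Q j + S) * (c • (1 : Matrix n n R) + Q j)⁻¹)
    {i j : ℕ} (hi : 1 ≤ i) (hj : 1 ≤ j)
    (hQinv : ∀ l, 1 ≤ l → l < i + j → IsUnit (c • (1 : Matrix n n R) + Q l)) :
    IsUnit (Q i + Q j) ∧ Q (i + j) * (Q i + Q j) = S + Q i * Q j := by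
  have hSQ : ∀ l, 1 ≤ l → Commute S (Q l) := fun l hl =>
    qIteration_commute_of_commute hQ1 hQrec (Commute.refl S) hl
  have hQQ : ∀ k l, 1 ≤ k → 1 ≤ l → Commute (Q k) (Q l) := fun k l hk hl =>
    qIteration_commute_of_commute hQ1 hQrec (hSQ k hk).symm hl
  have hstep : ∀ l, 1 ≤ l → l < i + j →
      Q (l + 1) * (c • (1 : Matrix n n R) + Q l) = c • Q l + S := fun l hl hlt => by
    rw [hQrec l hl, mul_assoc,
      Matrix.nonsing_inv_mul _ ((Matrix.isUnit_iff_isUnit_det _).1 (hQinv l hl hlt)), mul_one]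
  induction j, hj using Nat.le_induction with
  | base =>
    have hu := hQinv i hi (Nat.lt_succ_self i)
    have he := hstep i hi (Nat.lt_succ_self i)
    rw [hQ1, add_comm (Q i)]
    refine ⟨hu, he.trans ?_⟩
    rw [mul_smul_comm, mul_one, add_comm]
  | succ j hj ih =>
    obtain ⟨hu, he⟩ := ih (fun l hl hlt => hQinv l hl (by omega))
      (fun l hl hlt => hstep l hl (by omega))
    have huj := hQinv j hj (by omega)
    have huij := hQinv (i + j) (by omega) (by omega)
    have hD := hstep j hj (by omega)
    have hE := hstep (i + j) (by omega) (by omega)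
    have hcomm : Commute (Q i + Q j) (Q (i + j)) :=
      (hQQ i (i + j) hi (by omega)).add_left (hQQ j (i + j) hj (by omega))
    have hcomm' : Commute (Q i + Q j) (c • (1 : Matrix n n R) + Q (i + j)) :=
      ((Commute.one_right _).smul_right c).add_right hcomm
    have hfac : (Q i + Q (j + 1)) * (c • (1 : Matrix n n R) + Q j) =
        (Q i + Q j) * (c • (1 : Matrix n n R) + Q (i + j)) := by
      rw [add_mul, hD, mul_add (Q i + Q j), hcomm.eq, he]
      simp only [mul_add, mul_smul_comm, mul_one, smul_add]
      abel
    have hcommj : Commute (Q i + Q (j + 1)) (c • (1 : Matrix n n R) + Q j) :=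
      ((Commute.one_right _).smul_right c).add_right
        ((hQQ i j hi hj).add_left (hQQ (j + 1) j (by omega) hj))
    have hprod : IsUnit ((Q i + Q (j + 1)) * (c • (1 : Matrix n n R) + Q j)) :=
      hfac ▸ hu.mul huij
    refine ⟨(hcommj.isUnit_mul_iff.1 hprod).1, huj.mul_right_cancel ?_⟩
    calc Q (i + (j + 1)) * (Q i + Q (j + 1)) * (c • (1 : Matrix n n R) + Q j)
        = Q (i + j + 1) * (c • (1 : Matrix n n R) + Q (i + j)) * (Q i + Q j) := by
          rw [mul_assoc, hfac, hcomm'.eq, mul_assoc, add_assoc]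
      _ = c • (S + Q i * Q j) + S * (Q i + Q j) := by
          rw [hE, add_mul, smul_mul_assoc, he]
      _ = S * (c • (1 : Matrix n n R) + Q j) +
            Q i * (Q (j + 1) * (c • (1 : Matrix n n R) + Q j)) := by
          rw [hD, mul_add (Q i), ← (hSQ i hi).eq]
          simp only [mul_add, mul_smul_comm, mul_one, smul_add]
          abel
      _ = (S + Q i * Q (j + 1)) * (c • (1 : Matrix n n R) + Q j) := by
          rw [add_mul, mul_assoc]

end QIteration

/-- Discrete flow property of the Q-iteration: if it is breakdown-free up to
step `i + j`, then `Q_i + Q_j` is invertible and `Q_{i+j} = (S + Q_i Q_j)(Q_i + Q_j)⁻¹`;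
in particular for `i = j`, `Q_{2i} = (S + Q_i²)(2Q_i)⁻¹` (a Newton step for the square root). -/
theorem q_iteration_semigroup (n : ℕ) (hn : 0 < n)
    (S : Matrix (Fin n) (Fin n) ℂ) (γ : ℝ) (hγ : 0 < γ)
    (Q : ℕ → Matrix (Fin n) (Fin n) ℂ)
    (hQ1 : Q 1 = (γ : ℂ) • (1 : Matrix (Fin n) (Fin n) ℂ))
    (hQrec : ∀ j, 1 ≤ j →
      Q (j + 1) = ((γ : ℂ) • Q j + S) * ((γ : ℂ) • (1 : Matrix (Fin n) (Fin n) ℂ) + Q j)⁻¹)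
    (i j : ℕ) (hi : 1 ≤ i) (hj : 1 ≤ j)
    (hQinv : ∀ l, 1 ≤ l → l < i + j →
      IsUnit ((γ : ℂ) • (1 : Matrix (Fin n) (Fin n) ℂ) + Q l)) :
    IsUnit (Q i + Q j) ∧
      Q (i + j) = (S + Q i * Q j) * (Q i + Q j)⁻¹ ∧
      (i = j → Q (i + j) = (S + Q i ^ 2) * ((2 : ℂ) • Q i)⁻¹) := by
  obtain ⟨hu, he⟩ := qIteration_add hQ1 hQrec hi hj hQinv
  have hsum : Q (i + j) = (S + Q i * Q j) * (Q i + Q j)⁻¹ := by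
    rw [← he, mul_assoc,
      Matrix.mul_nonsing_inv _ ((Matrix.isUnit_iff_isUnit_det _).1 hu), mul_one]
  refine ⟨hu, hsum, ?_⟩
  rintro rfl
  rw [hsum, two_smul, pow_two]
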